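/- arXiv:cs/0509046 — 3 statements merged into one kernel-verified Lean document; each statement's English description precedes it below -/
import Mathlib

section
/- As p → ∞, log T_t(p) ≤ (α·p/log p)(1 + O(log log p / log p)), where α = h(1/t)·t·log t and T_t(p) is the number of t-ary trees with path length p. -/
/-- A `t`-ary tree: either empty, or a root node with `t` ordered subtrees. -/
inductive TAry (t : ℕ) : Type where
  | nil : TAry t
  | node : (Fin t → TAry t) → TAry t

namespace TAry

variable {t : ℕ}

/-- Number of nodes of a `t`-ary tree. -/
def size : TAry t → ℕ
  | nil => 0
  | node c => 1 + ∑ i, (c i).size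

/-- Sum over nodes of `d +` (depth of the node). -/
def plFrom : TAry t → ℕ → ℕ
  | nil, _ => 0
  | node c, d => d + ∑ i, (c i).plFrom (d + 1)

/-- Path length: the sum of the depths of all nodes. -/
def pathLength (T : TAry t) : ℕ := T.plFrom 0

/-- Number of nodes at depth `j` (the profile `D_j`). -/
def depthCount : ℕ → TAry t → ℕ
  | _, nil => 0
  | 0, node _ => 1
  | j + 1, node c => ∑ i, depthCount j (c i)

/-- Number of leaves (nodes all of whose subtrees are empty). -/
def leaves : TAry t → ℕ
  | nil => 0
  | node c => max 1 (∑ i, (c i).leaves)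

end TAry

namespace TAry
variable {t : ℕ}

/-- Every internal (non-leaf) node has exactly one child. -/
def chain : TAry t → Prop
  | nil => True
  | node c => (∀ i, c i = nil) ∨ ∃ i, c i ≠ nil ∧ chain (c i) ∧ ∀ j, j ≠ i → c j = nil

/-- Number of leaves at depth `j`. -/
def leavesAt : ℕ → TAry t → ℕ
  | _, nil => 0
  | 0, node c => if (∑ i, (c i).size) = 0 then 1 else 0
  | j + 1, node c => ∑ i, leavesAt j (c i)

/-- The subtree of `T` at position `pos` (empty tree if the position is invalid). -/
def getAt : TAry t → List (Fin t) → TAry t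
  | T, [] => T
  | nil, _ :: _ => nil
  | node c, i :: rest => getAt (c i) rest

/-- Replace the subtree of `T` at position `pos` by `τ`. -/
def replaceAt : TAry t → List (Fin t) → TAry t → TAry t
  | _, [], τ => τ
  | nil, _ :: _, _ => nil
  | node c, i :: rest, τ => node (fun j => if j = i then replaceAt (c i) rest τ else c j)

/-- Attach the trees `τs i` at the positions `pos i`, for `i = 0, …, ℓ-1`. -/
def attachAll {ℓ : ℕ} (T : TAry t) (pos : Fin ℓ → List (Fin t)) (τs : Fin ℓ → TAry t) :
    TAry t :=
  (List.finRange ℓ).foldl (fun A i => replaceAt A (pos i) (τs i)) T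

end TAry

/-- The binary entropy function (natural logarithm). -/
noncomputable def binEnt (x : ℝ) : ℝ := -x * Real.log x - (1 - x) * Real.log (1 - x)

/-- Number of `t`-ary trees with exactly `n` nodes. -/
noncomputable def Ct (t n : ℕ) : ℕ := Nat.card {T : TAry t // T.size = n}

/-- Number of `t`-ary trees with path length exactly `p`. -/
noncomputable def Tt (t p : ℕ) : ℕ := Nat.card {T : TAry t // T.pathLength = p}

namespace TAry

theorem size_le_aux {t : ℕ} (ht : 2 ≤ t) (K : ℕ) (T : TAry t) :
    ∀ d, (K ≤ d → K * T.size ≤ T.plFrom d) ∧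
      (d ≤ K → K * T.size + K ≤ T.plFrom d + K * t ^ (K - d)) := by
  induction T with
  | nil =>
    intro d
    refine ⟨fun _ => by simp [size], fun _ => ?_⟩
    have : 1 ≤ t ^ (K - d) := Nat.one_le_pow _ _ (by omega)
    simp only [size, plFrom]
    nlinarith
  | node c ih =>
    intro d
    have h1 : K ≤ d → K * (node c).size ≤ (node c).plFrom d := by
      intro hd
      have : ∑ i, K * (c i).size ≤ ∑ i, (c i).plFrom (d + 1) :=
        Finset.sum_le_sum fun i _ => (ih i (d + 1)).1 (by omega)
      rw [← Finset.mul_sum] at this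
      simp only [size, plFrom]
      nlinarith
    refine ⟨h1, fun hd => ?_⟩
    rcases Nat.eq_or_lt_of_le hd with h | h
    · have := h1 h.ge
      subst h
      simpa using this
    · have : ∑ i, (K * (c i).size + K) ≤
          ∑ i, ((c i).plFrom (d + 1) + K * t ^ (K - (d + 1))) :=
        Finset.sum_le_sum fun i _ => (ih i (d + 1)).2 (by omega)
      rw [Finset.sum_add_distrib, Finset.sum_add_distrib, ← Finset.mul_sum] at this
      simp only [Finset.sum_const, Finset.card_univ, Fintype.card_fin, smul_eq_mul] at this
      have e : K - d = (K - (d + 1)) + 1 := by omega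
      rw [e, pow_succ]
      simp only [size, plFrom]
      have h2 : 2 * K ≤ t * K := Nat.mul_le_mul_right _ ht
      nlinarith

theorem size_le {t : ℕ} (ht : 2 ≤ t) {k p : ℕ} (hk : 1 ≤ k) (T : TAry t)
    (hT : T.pathLength = p) : T.size ≤ p / k + t ^ k := by
  have h := (size_le_aux ht k T 0).2 (by omega)
  have hT' : T.plFrom 0 = p := hT
  rw [hT', Nat.sub_zero] at h
  have : T.size - t ^ k ≤ p / k := by
    rw [Nat.le_div_iff_mul_le (by omega), Nat.sub_mul]
    rw [mul_comm (T.size), mul_comm (t ^ k)]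
    omega
  omega

open Classical in
theorem sum_le {t : ℕ} (x B : ℝ) (hx : 0 ≤ x) (hB : 1 + x * B ^ t ≤ B) (hB0 : 1 ≤ B) (N : ℕ) :
    ∀ S : Finset (TAry t), (∀ T ∈ S, T.size ≤ N) → ∑ T ∈ S, x ^ T.size ≤ B := by
  induction N with
  | zero =>
    intro S hS
    have hsub : S ⊆ {nil} := by
      intro T hT
      have := hS T hT
      cases T with
      | nil => simp
      | node c => simp [size] at this
    calc ∑ T ∈ S, x ^ T.size ≤ ∑ T ∈ ({nil} : Finset (TAry t)), x ^ T.size :=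
          Finset.sum_le_sum_of_subset_of_nonneg hsub fun _ _ _ => pow_nonneg hx _
      _ ≤ B := by simpa [size] using hB0
  | succ N ih =>
    intro S hS
    let kids : TAry t → Finset (TAry t) := fun T =>
      match T with
      | nil => ∅
      | node c => Finset.univ.image c
    let S' := S.biUnion kids
    have hS' : ∀ T ∈ S', T.size ≤ N := by
      intro T hT
      obtain ⟨U, hU, hTU⟩ := Finset.mem_biUnion.1 hT
      have h := hS U hU
      cases U with
      | nil => simp [kids] at hTU
      | node c =>
        simp only [kids, Finset.mem_image, Finset.mem_univ, true_and] at hTU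
        obtain ⟨i, rfl⟩ := hTU
        simp only [size] at h
        have := Finset.single_le_sum (f := fun i => (c i).size) (fun _ _ => Nat.zero_le _)
          (Finset.mem_univ i)
        omega
    let F : Finset (Fin t → TAry t) := Fintype.piFinset fun _ => S'
    have hsub : S ⊆ insert nil (F.image node) := by
      intro T hT
      cases T with
      | nil => simp
      | node c =>
        refine Finset.mem_insert_of_mem (Finset.mem_image_of_mem _ ?_)
        refine Fintype.mem_piFinset.2 fun i => ?_
        exact Finset.mem_biUnion.2 ⟨_, hT, by simp [kids]⟩
    calc ∑ T ∈ S, x ^ T.size ≤ ∑ T ∈ insert nil (F.image node), x ^ T.size :=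
          Finset.sum_le_sum_of_subset_of_nonneg hsub fun _ _ _ => pow_nonneg hx _
      _ = 1 + ∑ c ∈ F, x ^ (node c).size := by
          rw [Finset.sum_insert (by simp), Finset.sum_image]
          · simp [size]
          · intro a _ b _ h
            exact node.inj h
      _ = 1 + x * ∑ c ∈ F, ∏ i, x ^ (c i).size := by
          rw [Finset.mul_sum]
          congr 1
          refine Finset.sum_congr rfl fun c _ => ?_
          simp only [size]
          rw [pow_add, pow_one, Finset.prod_pow_eq_pow_sum]
      _ = 1 + x * (∑ T ∈ S', x ^ T.size) ^ t := by
          congr 2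
          have := Finset.prod_univ_sum (fun _ : Fin t => S') (fun _ T => x ^ T.size)
          rw [← this]
          simp
      _ ≤ 1 + x * B ^ t := by
          have h0 : 0 ≤ ∑ T ∈ S', x ^ T.size := Finset.sum_nonneg fun _ _ => pow_nonneg hx _
          have := ih S' hS'
          gcongr
      _ ≤ B := hB

end TAry

theorem Tt_mul_le {t : ℕ} (ht : 2 ≤ t) {k p : ℕ} (hk : 1 ≤ k) (x B : ℝ) (hx : 0 ≤ x) (hx1 : x ≤ 1)
    (hB : 1 + x * B ^ t ≤ B) (hB0 : 1 ≤ B) : (Tt t p : ℝ) * x ^ (p / k + t ^ k) ≤ B := by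
  unfold Tt
  rcases finite_or_infinite {T : TAry t // T.pathLength = p} with hf | hf
  · have hfin : {T : TAry t | T.pathLength = p}.Finite := hf
    have hc : Nat.card {T : TAry t // T.pathLength = p} = hfin.toFinset.card :=
      Nat.card_eq_card_finite_toFinset hfin
    rw [hc]
    have hs : ∀ T ∈ hfin.toFinset, T.size ≤ p / k + t ^ k := fun T hT =>
      TAry.size_le ht hk T (by simpa using hT)
    refine le_trans ?_ (TAry.sum_le x B hx hB hB0 _ _ hs)
    rw [← nsmul_eq_mul]
    exact Finset.card_nsmul_le_sum _ _ _ fun T hT => pow_le_pow_of_le_one hx hx1 (hs T hT)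
  · rw [Nat.card_eq_zero_of_infinite]
    simp
    linarith

/-- Exponential growth rate facts. -/
theorem ent_eq (s : ℕ) (hs : 1 ≤ s) :
    binEnt (1 / ((s + 1 : ℕ) : ℝ)) * ((s + 1 : ℕ) : ℝ) =
      - Real.log ((s : ℝ) ^ s / (s + 1) ^ (s + 1)) := by
  have h1 : (0 : ℝ) < s := by exact_mod_cast hs
  have h2 : (0 : ℝ) < s + 1 := by positivity
  unfold binEnt
  have e : (1 : ℝ) - 1 / ((s + 1 : ℕ) : ℝ) = s / (s + 1) := by
    push_cast; field_simp; ring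
  rw [e, Real.log_div (by positivity) (by positivity), Real.log_div (by positivity) (by positivity),
    Real.log_div (by positivity) (by positivity), Real.log_pow, Real.log_pow]
  push_cast
  rw [Real.log_one]
  field_simp
  ring

theorem log_Tt_le {t : ℕ} (ht : 2 ≤ t) : 0 < binEnt (1 / t) * t ∧ ∀ k p : ℕ, 1 ≤ k →
    Real.log (Tt t p) ≤ 1 + binEnt (1 / t) * t * (p / k + (t : ℝ) ^ k) := by
  obtain ⟨s, rfl⟩ : ∃ s, t = s + 1 := ⟨t - 1, by omega⟩
  have hs : 1 ≤ s := by omega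
  have hs1 : (1 : ℝ) ≤ s := by exact_mod_cast hs
  rw [ent_eq s hs]
  set x : ℝ := (s : ℝ) ^ s / (s + 1) ^ (s + 1) with hxdef
  have hx : 0 < x := by positivity
  have hx1 : x < 1 := by
    rw [hxdef, div_lt_one (by positivity), pow_succ]
    have : (s : ℝ) ^ s ≤ (s + 1) ^ s := by gcongr; linarith
    have h3 : (0 : ℝ) < (s + 1) ^ s := by positivity
    nlinarith
  have hH : 0 < - Real.log x := by
    have := Real.log_neg hx hx1
    linarith
  refine ⟨hH, fun k p hk => ?_⟩
  have hB0 : (1 : ℝ) ≤ (s + 1) / s := by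
    rw [le_div_iff₀ (by positivity)]; linarith
  have hB : 1 + x * (((s : ℝ) + 1) / s) ^ (s + 1) ≤ (s + 1) / s := by
    apply le_of_eq
    rw [hxdef, div_pow, pow_succ (s : ℝ) s]
    field_simp
    try ring
  have h := Tt_mul_le (p := p) ht hk x _ hx.le hx1.le hB hB0
  have hN : ((p / k + (s + 1) ^ k : ℕ) : ℝ) ≤ p / k + ((s + 1 : ℕ) : ℝ) ^ k := by
    push_cast
    gcongr
    exact Nat.cast_div_le
  set N := p / k + (s + 1) ^ k
  have hmain : Real.log (Tt (s + 1) p) ≤ 1 + (- Real.log x) * N := by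
    rcases Nat.eq_zero_or_pos (Tt (s + 1) p) with h0 | h0
    · rw [h0]; simp only [Nat.cast_zero, Real.log_zero]; positivity
    · have hp : (0 : ℝ) < Tt (s + 1) p := by exact_mod_cast h0
      have hl := Real.log_le_log (by positivity) h
      rw [Real.log_mul (by positivity) (by positivity), Real.log_pow] at hl
      have hb : Real.log (((s : ℝ) + 1) / s) ≤ 1 := by
        have h4 := Real.log_le_sub_one_of_pos (x := ((s : ℝ) + 1) / s) (by positivity)
        have h5 : ((s : ℝ) + 1) / s ≤ 2 := by
          rw [div_le_iff₀ (by positivity)]; linarith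
        linarith
      linarith
  have := mul_le_mul_of_nonneg_left hN hH.le
  linarith

/-- `log T_t(p) ≤ (α p / log p)(1 + O(log log p / log p))` with `α = h(1/t) t log t`. -/
theorem stmt12 (t : ℕ) (ht : 2 ≤ t) :
    ∃ c : ℝ, ∃ P₀ : ℕ, ∀ p : ℕ, P₀ ≤ p →
      Real.log (Tt t p) ≤
        (binEnt (1 / t) * t * Real.log t) * p / Real.log p *
          (1 + c * Real.log (Real.log p) / Real.log p) := by
  obtain ⟨hH, hmain⟩ := log_Tt_le ht
  set H := binEnt (1 / t) * t with hHdef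
  set a := Real.log t with ha_def
  have ht' : (2 : ℝ) ≤ t := by exact_mod_cast ht
  have ha : 0 < a := Real.log_pos (by linarith)
  refine ⟨4 + 2 * a + 1 / a + 1 / (H * a), ?_⟩
  have hLtop : Filter.Tendsto (fun p : ℕ => Real.log (p : ℝ)) Filter.atTop Filter.atTop :=
    Real.tendsto_log_atTop.comp tendsto_natCast_atTop_atTop
  have hll : ∀ᶠ L : ℝ in Filter.atTop, Real.log L ≤ 1 / 8 * L := by
    have := Real.isLittleO_log_id_atTop.bound (c := 1 / 8) (by norm_num)
    filter_upwards [this, Filter.eventually_ge_atTop 1] with L hL h1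
    simp only [Real.norm_eq_abs, id] at hL
    rw [abs_of_pos (a := L) (by linarith)] at hL
    exact (le_abs_self _).trans hL
  have ev := hLtop.eventually (hll.and (Filter.eventually_ge_atTop (max (4 * a) (Real.exp 1))))
  obtain ⟨P₀, hP⟩ := Filter.eventually_atTop.1 ev
  refine ⟨P₀ + 1, fun p hp => ?_⟩
  obtain ⟨hlog, hmax⟩ := hP p (by omega)
  have hp0 : (0 : ℝ) < p := by
    have : 0 < p := by omega
    exact_mod_cast this
  set L := Real.log (p : ℝ) with hL
  have hLa : 4 * a ≤ L := (le_max_left _ _).trans hmax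
  have hLe : Real.exp 1 ≤ L := (le_max_right _ _).trans hmax
  have hL0 : 0 < L := (Real.exp_pos 1).trans_le hLe
  set l := Real.log L with hl
  have hl1 : 1 ≤ l := by
    rw [hl, Real.le_log_iff_exp_le hL0]; exact hLe
  have hpL : (p : ℝ) = Real.exp L := (Real.exp_log hp0).symm
  have hk1 : 1 ≤ (L - 2 * l) / a := by
    rw [le_div_iff₀ ha]; linarith
  set k := ⌊(L - 2 * l) / a⌋₊ with hk
  have hkpos : 1 ≤ k := Nat.le_floor (by simpa using hk1)
  have hkle : (k : ℝ) * a ≤ L - 2 * l := by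
    rw [← le_div_iff₀ ha]; exact Nat.floor_le (by linarith)
  have hkge : L - 2 * l - a ≤ k * a := by
    have := Nat.lt_floor_add_one ((L - 2 * l) / a)
    rw [div_lt_iff₀ ha] at this
    rw [← hk] at this
    linarith
  have htk : (t : ℝ) ^ k ≤ p / L ^ 2 := by
    have e1 : (t : ℝ) ^ k = Real.exp (k * a) := by
      rw [Real.exp_nat_mul, ha_def, Real.exp_log (by linarith)]
    have e2 : (p : ℝ) / L ^ 2 = Real.exp (L - 2 * l) := by
      rw [Real.exp_sub, ← hpL]
      congr 1
      rw [show 2 * l = ((2 : ℕ) : ℝ) * l by norm_num, Real.exp_nat_mul, hl, Real.exp_log hL0]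
    rw [e1, e2]
    exact Real.exp_le_exp.2 hkle
  have h1le : 1 ≤ (p : ℝ) / L ^ 2 := by
    have : (1 : ℝ) ≤ (t : ℝ) ^ k := one_le_pow₀ (by linarith)
    linarith
  have hk0 : (0 : ℝ) < k := by exact_mod_cast hkpos
  have hpk : (p : ℝ) / k ≤ p * a / L * (1 + (4 * l + 2 * a) / L) := by
    have e : (p : ℝ) * a / L * (1 + (4 * l + 2 * a) / L) =
        p * (a * (L + 4 * l + 2 * a) / L ^ 2) := by
      field_simp
      try ring
    rw [e, div_eq_mul_inv]
    refine mul_le_mul_of_nonneg_left ?_ hp0.le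
    rw [inv_eq_one_div, div_le_div_iff₀ hk0 (by positivity)]
    have h5 : (L - 2 * l - a) * (L + 4 * l + 2 * a) ≤ (k * a) * (L + 4 * l + 2 * a) :=
      mul_le_mul_of_nonneg_right hkge (by linarith)
    have h6 : 0 ≤ (2 * l + a) * (L - 2 * (2 * l + a)) :=
      mul_nonneg (by linarith) (by linarith)
    nlinarith
  have hm := hmain k p hkpos
  set q := (p : ℝ) / L ^ 2 with hq
  have hq' : (p : ℝ) / L = q * L := by rw [hq]; field_simp
  have e3 : (H * a) * (p : ℝ) / L * (1 + (4 + 2 * a + 1 / a + 1 / (H * a)) * l / L)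
      = H * (p * a / L) + H * a * q * (4 + 2 * a) * l + H * q * l + q * l := by
    rw [hq]; field_simp
    try ring
  have e4 : (p : ℝ) * a / L * (1 + (4 * l + 2 * a) / L) = p * a / L + a * q * (4 * l + 2 * a) := by
    rw [hq]; field_simp
    try ring
  rw [e3]
  rw [e4] at hpk
  have hq0 : 0 < q := by linarith
  have h7 : H * (p / k + (t : ℝ) ^ k) ≤ H * (p * a / L + a * q * (4 * l + 2 * a) + q) :=
    mul_le_mul_of_nonneg_left (by linarith) hH.le
  have h8 : 1 ≤ q * l := by nlinarith
  have h9 : H * q ≤ H * q * l := le_mul_of_one_le_right (by positivity) hl1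
  have h10 : H * a * q * (2 * a) ≤ H * a * q * (2 * a) * l :=
    le_mul_of_one_le_right (by positivity) hl1
  nlinarith
end

section
/- As p → ∞, log T_t(p) ≥ (α·p/log p)(1 − O((log p)^{-1/2})), where α = h(1/t)·t·log t and T_t(p) is the number of t-ary trees with path length p. -/
namespace TAry

theorem finite_size_le {t : ℕ} (n : ℕ) : {T : TAry t | T.size ≤ n}.Finite := by
  induction n with
  | zero =>
    refine (Set.finite_singleton (nil : TAry t)).subset ?_
    intro T hT
    cases T with
    | nil => simp
    | node c => simp [size] at hT
  | succ n ih =>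
    have h1 : (Set.pi Set.univ (fun _ : Fin t => {T : TAry t | T.size ≤ n})).Finite :=
      Set.Finite.pi (fun _ => ih)
    refine ((h1.image node).insert nil).subset ?_
    intro T hT
    cases T with
    | nil => simp
    | node c =>
      right
      refine ⟨c, ?_, rfl⟩
      intro i _
      simp only [Set.mem_ofPred_eq, size] at hT ⊢
      have := Finset.single_le_sum (f := fun i => (c i).size) (fun _ _ => Nat.zero_le _)
        (Finset.mem_univ i)
      have h5 : (c i).size ≤ ∑ i, (c i).size := this
      omega

theorem size_le_plFrom {t : ℕ} (T : TAry t) : ∀ d, 1 ≤ d → T.size ≤ T.plFrom d := by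
  induction T with
  | nil => intro d _; simp [size]
  | node c ih =>
    intro d hd
    simp only [size, plFrom]
    have : ∑ i, (c i).size ≤ ∑ i, (c i).plFrom (d + 1) :=
      Finset.sum_le_sum (fun i _ => ih i (d + 1) (by omega))
    omega

theorem size_le_plFrom_succ {t : ℕ} (T : TAry t) (d : ℕ) : T.size ≤ T.plFrom d + 1 := by
  cases T with
  | nil => simp [size]
  | node c =>
    simp only [size, plFrom]
    have : ∑ i, (c i).size ≤ ∑ i, (c i).plFrom (d + 1) :=
      Finset.sum_le_sum (fun i _ => size_le_plFrom (c i) (d + 1) (by omega))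
    omega

/-- Forests of `w` nonempty trees rooted at depth `d`, of total path length `p`. -/
def Forest (t w d p : ℕ) : Type :=
  {f : Fin w → TAry t // (∀ i, f i ≠ nil) ∧ ∑ i, (f i).plFrom d = p}

instance forestFinite (t w d p : ℕ) : Finite (Forest t w d p) := by
  have h1 : (Set.pi Set.univ (fun _ : Fin w => {T : TAry t | T.size ≤ p + 1})).Finite :=
    Set.Finite.pi (fun _ => finite_size_le _)
  refine Set.Finite.to_subtype (h1.subset ?_)
  intro f hf i _
  have h2 := Finset.single_le_sum (f := fun i => (f i).plFrom d) (fun _ _ => Nat.zero_le _)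
        (Finset.mem_univ i)
  have h3 := size_le_plFrom_succ (f i) d
  have h4 := hf.2
  simp only [Set.mem_ofPred_eq] at *
  omega

/-- Build a level on top of a forest. -/
noncomputable def build {t w w' : ℕ} (S : Finset (Fin w × Fin t)) (h : S.card = w')
    (g : Fin w' → TAry t) (i : Fin w) : TAry t :=
  node (fun j => if hm : (i, j) ∈ S then g (S.equivFinOfCardEq h ⟨(i, j), hm⟩) else nil)

theorem build_sum {t w w' : ℕ} (S : Finset (Fin w × Fin t)) (h : S.card = w')
    (g : Fin w' → TAry t) (d : ℕ) :
    ∑ i, (build S h g i).plFrom d = ∑ i, (g i).plFrom (d + 1) + w * d := by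
  simp only [build, plFrom]
  rw [Finset.sum_add_distrib]
  simp only [Finset.sum_const, Finset.card_univ, Fintype.card_fin, smul_eq_mul]
  rw [add_comm]
  congr 1
  rw [← Fintype.sum_prod_type' (f := fun i j => (if hm : (i, j) ∈ S then
    g (S.equivFinOfCardEq h ⟨(i, j), hm⟩) else nil).plFrom (d + 1))]
  rw [← Equiv.sum_comp (S.equivFinOfCardEq h)]
  rw [← Finset.sum_subset (Finset.subset_univ S)]
  · rw [← Finset.sum_coe_sort S]
    refine Finset.sum_congr rfl ?_
    rintro ⟨x, hx⟩ _
    simp [hx]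
  · intro x _ hx
    simp [hx, plFrom]

theorem build_inj {t w w' : ℕ} (S S' : Finset (Fin w × Fin t)) (h : S.card = w')
    (h' : S'.card = w') (g g' : Fin w' → TAry t) (hg : ∀ i, g i ≠ nil) (hg' : ∀ i, g' i ≠ nil)
    (hb : build S h g = build S' h' g') : S = S' ∧ g = g' := by
  have key : ∀ i j, (if hm : (i, j) ∈ S then g (S.equivFinOfCardEq h ⟨(i, j), hm⟩) else nil)
      = (if hm : (i, j) ∈ S' then g' (S'.equivFinOfCardEq h' ⟨(i, j), hm⟩) else nil) := by
    intro i j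
    have := congrFun hb i
    simp only [build, node.injEq] at this
    exact congrFun this j
  have hS : S = S' := by
    ext ⟨i, j⟩
    have := key i j
    by_cases h1 : (i, j) ∈ S <;> by_cases h2 : (i, j) ∈ S' <;> simp only [h1, h2, dif_pos, dif_neg, not_false_eq_true] at this ⊢
    · exact absurd this (hg _)
    · exact absurd this.symm (hg' _)
  subst hS
  refine ⟨rfl, ?_⟩
  funext i
  have := key ((S.equivFinOfCardEq h).symm i).1.1 ((S.equivFinOfCardEq h).symm i).1.2
  simpa using this

/-- number of forests -/
noncomputable def fc (t w d p : ℕ) : ℕ := Nat.card (Forest t w d p)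

theorem fc_step (t w w' d p : ℕ) :
    (t * w).choose w' * fc t w' (d + 1) p ≤ fc t w d (p + w * d) := by
  have hc : (t * w).choose w' =
      Nat.card (Finset.powersetCard w' (Finset.univ : Finset (Fin w × Fin t))) := by
    simp [mul_comm]
  rw [hc, fc, ← Nat.card_prod]
  refine Nat.card_le_card_of_injective (fun x => ⟨build x.1.1 (Finset.mem_powersetCard.1 x.1.2).2 x.2.1, ?_, ?_⟩) ?_
  · intro i
    simp [build]
  · rw [build_sum, x.2.2.2]
  · rintro ⟨⟨S, hS⟩, ⟨g, hg, hg2⟩⟩ ⟨⟨S', hS'⟩, ⟨g', hg', hg2'⟩⟩ hh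
    have := build_inj S S' _ _ g g' hg hg' (congrArg Subtype.val hh)
    obtain ⟨rfl, rfl⟩ := this
    rfl

theorem fc_zero (t d : ℕ) : 1 ≤ fc t 0 d 0 := by
  have : Nonempty (Forest t 0 d 0) := ⟨⟨fun i => i.elim0, fun i => i.elim0, by simp⟩⟩
  exact Nat.card_pos

theorem fc_one (t w d : ℕ) : 1 ≤ fc t w d (w * d) := by
  have := fc_step t w 0 d 0
  have h2 := fc_zero t (d + 1)
  simp at this
  omega

theorem fc_two (t w r d : ℕ) (h : r ≤ t * w) : 1 ≤ fc t w d (w * d + r * (d + 1)) := by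
  have := fc_step t w r d (r * (d + 1))
  rw [add_comm]
  refine le_trans ?_ this
  exact Nat.mul_pos (Nat.choose_pos h) (fc_one _ _ _)

theorem fc_const (t L m d p : ℕ) :
    (t * L).choose L ^ m * fc t L (d + m) p ≤ fc t L d (p + ∑ j ∈ Finset.range m, L * (d + j)) := by
  induction m generalizing p with
  | zero => simp
  | succ m ih =>
    have h1 := fc_step t L L (d + m) p
    have h2 := ih (p + L * (d + m))
    rw [Finset.sum_range_succ, pow_succ, mul_assoc]
    refine (Nat.mul_le_mul_left _ h1).trans (h2.trans (le_of_eq ?_))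
    congr 1
    ring

theorem fc_complete (t k p : ℕ) :
    fc t (t ^ k) k p ≤ fc t 1 0 (p + ∑ j ∈ Finset.range k, t ^ j * j) := by
  induction k generalizing p with
  | zero => simp
  | succ k ih =>
    have h1 := fc_step t (t ^ k) (t ^ (k + 1)) k p
    rw [← pow_succ', Nat.choose_self, one_mul] at h1
    have h2 := ih (p + t ^ k * k)
    rw [Finset.sum_range_succ]
    refine h1.trans (h2.trans (le_of_eq ?_))
    congr 1
    ring

theorem fc_le_Tt (t p : ℕ) : fc t 1 0 p ≤ Tt t p := by
  have : Finite {T : TAry t // T.pathLength = p} := by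
    refine Set.Finite.to_subtype ((finite_size_le (t := t) (p + 1)).subset ?_)
    intro T hT
    have h := size_le_plFrom_succ T 0
    simp only [pathLength, Set.mem_ofPred_eq] at hT ⊢
    have : T.plFrom 0 = p := hT
    omega
  refine Nat.card_le_card_of_injective (fun x => ⟨x.1 0, ?_⟩) ?_
  · have := x.2.2
    simpa [pathLength] using this
  · rintro ⟨f, hf⟩ ⟨g, hg⟩ hh
    have h0 : f 0 = g 0 := congrArg Subtype.val hh
    have : f = g := by
      funext i
      rw [Subsingleton.elim i 0, h0]
    subst this
    rfl

/-- base path length -/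
def base (t k m : ℕ) : ℕ :=
  ∑ j ∈ Finset.range k, t ^ j * j + ∑ j ∈ Finset.range (m + 1), t ^ k * (k + j)

theorem main_count (t k m p : ℕ) (ht : 2 ≤ t)
    (h1 : base t k m + 2 * (k + m + 1) ^ 2 ≤ p)
    (h2 : p ≤ base t k m + 2 * t ^ k * (k + m + 1)) :
    (t * t ^ k).choose (t ^ k) ^ m ≤ Tt t p := by
  obtain ⟨R, rfl⟩ := Nat.exists_eq_add_of_le (le_trans (Nat.le_add_right _ _) h1)
  set e := k + m + 1 with he
  have hR1 : 2 * e ^ 2 ≤ R := by omega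
  have hR2 : R ≤ 2 * t ^ k * e := by omega
  have hepos : 0 < e := by omega
  set q := R / e with hq
  set r := R % e with hr
  have hqr : e * q + r = R := Nat.div_add_mod R e
  have hre : r < e := Nat.mod_lt _ hepos
  have hq1 : 2 * e ≤ q := by
    rw [hq, Nat.le_div_iff_mul_le hepos]; nlinarith
  have hq2 : q ≤ 2 * t ^ k := Nat.div_le_of_le_mul (by linarith)
  obtain ⟨w, hw⟩ : ∃ w, q = w + r := ⟨q - r, by omega⟩
  have hrw : r ≤ t * w := by nlinarith
  have hwL : w ≤ t * t ^ k := by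
    have : 2 * t ^ k ≤ t * t ^ k := Nat.mul_le_mul_right _ ht
    omega
  have a1 := fc_two t w r e hrw
  have a2 := fc_step t (t ^ k) w (k + m) (w * e + r * (e + 1))
  have a3 := fc_const t (t ^ k) m k (w * e + r * (e + 1) + t ^ k * (k + m))
  have a4 := fc_complete t k (w * e + r * (e + 1) + t ^ k * (k + m) + ∑ j ∈ Finset.range m, t ^ k * (k + j))
  have a5 : w * e + r * (e + 1) + t ^ k * (k + m) + ∑ j ∈ Finset.range m, t ^ k * (k + j) +
      ∑ j ∈ Finset.range k, t ^ j * j = base t k m + R := by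
    rw [base, Finset.sum_range_succ, ← hqr, hw]; ring
  rw [a5] at a4
  have a6 : 1 ≤ fc t (t ^ k) (k + m) (w * e + r * (e + 1) + t ^ k * (k + m)) := by
    refine le_trans ?_ a2
    exact Nat.mul_pos (Nat.choose_pos hwL) a1
  refine le_trans ?_ (fc_le_Tt t _)
  refine le_trans ?_ a4
  refine le_trans ?_ a3
  exact Nat.le_mul_of_pos_right _ a6

end TAry

theorem choose_bound (u L : ℕ) :
    (u + 1) ^ ((u + 1) * L) ≤
      ((u + 1) * L + 1) * (((u + 1) * L).choose L * u ^ (u * L)) := by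
  set n := (u + 1) * L with hn
  have hnL : n - L = u * L := by rw [hn]; rw [add_mul, one_mul]; omega
  have hnL' : n = u * L + L := by rw [hn]; ring
  let f : ℕ → ℕ := fun i => n.choose i * u ^ (n - i)
  have rel : ∀ i, i < n → (i + 1) * f (i + 1) = (n - i) * (n.choose i * u ^ (n - i - 1)) ∧
      (i + 1) * f i = ((i + 1) * u) * (n.choose i * u ^ (n - i - 1)) := by
    intro i hi
    constructor
    · have := Nat.choose_succ_right_eq n i
      simp only [f]
      rw [show n - (i + 1) = n - i - 1 by omega]
      calc _ = (n.choose (i + 1) * (i + 1)) * u ^ (n - i - 1) := by ring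
        _ = _ := by rw [this]; ring
    · simp only [f]
      obtain ⟨x, hx⟩ : ∃ x, n - i = x + 1 := ⟨n - i - 1, by omega⟩
      rw [hx, Nat.add_sub_cancel, pow_succ]; ring
  have up : ∀ i, i < L → f i ≤ f (i + 1) := by
    intro i hi
    have hin : i < n := by rw [hnL']; omega
    obtain ⟨r1, r2⟩ := rel i hin
    refine Nat.le_of_mul_le_mul_left ?_ (Nat.succ_pos i)
    rw [Nat.succ_eq_add_one, r1, r2]
    refine Nat.mul_le_mul_right _ ?_
    have : (i + 1) * u ≤ u * L := by rw [mul_comm]; exact Nat.mul_le_mul_left _ hi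
    omega
  have down : ∀ i, L ≤ i → f (i + 1) ≤ f i := by
    intro i hi
    by_cases hin : i < n
    · obtain ⟨r1, r2⟩ := rel i hin
      refine Nat.le_of_mul_le_mul_left ?_ (Nat.succ_pos i)
      rw [Nat.succ_eq_add_one, r1, r2]
      refine Nat.mul_le_mul_right _ ?_
      have : u * L ≤ (i + 1) * u := by rw [mul_comm (i + 1)]; exact Nat.mul_le_mul_left _ (by omega)
      omega
    · simp only [f]
      rw [Nat.choose_eq_zero_of_lt (by omega)]; simp
  have hmax : ∀ i, f i ≤ f L := by
    intro i
    rcases le_total i L with h | h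
    · have : ∀ j, i ≤ j → j ≤ L → f i ≤ f j := by
        intro j hj
        induction j, hj using Nat.le_induction with
        | base => intro _; exact le_rfl
        | succ j hj ih => intro h'; exact (ih (by omega)).trans (up j (by omega))
      exact this L h le_rfl
    · induction i, h using Nat.le_induction with
      | base => exact le_rfl
      | succ j hj ih => exact (down j hj).trans ih
  have hs : (u + 1) ^ n = ∑ i ∈ Finset.range (n + 1), f i := by
    rw [add_comm, add_pow]
    refine Finset.sum_congr rfl fun i _ => ?_
    simp [f, mul_comm]
  rw [hs, ← hnL]
  have := Finset.sum_le_card_nsmul (Finset.range (n + 1)) f (f L) (fun i _ => hmax i)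
  simpa using this

theorem exists_between_steps (f : ℕ → ℕ) (a p : ℕ) (hf : ∀ n, n ≤ f n) (ha : f a ≤ p) :
    ∃ k, a ≤ k ∧ f k ≤ p ∧ p < f (k + 1) := by
  by_contra hcon
  push Not at hcon
  have : ∀ k, a ≤ k → f k ≤ p := by
    intro k hk
    induction k, hk using Nat.le_induction with
    | base => exact ha
    | succ j hj ih => exact hcon j hj ih
  have h1 := this (a + p + 1) (by omega)
  have h2 := hf (a + p + 1)
  omega

theorem base_upper (t k m : ℕ) (ht : 2 ≤ t) :
    TAry.base t k m ≤ t ^ k * k + t ^ k * ((m + 1) * (k + m)) := by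
  unfold TAry.base
  refine Nat.add_le_add ?_ ?_
  · have h1 : ∑ j ∈ Finset.range k, t ^ j ≤ t ^ k := by
      clear m
      induction k with
      | zero => simp
      | succ k ih => rw [Finset.sum_range_succ, pow_succ]; have := Nat.mul_le_mul_left (t ^ k) ht; omega
    calc ∑ j ∈ Finset.range k, t ^ j * j ≤ ∑ j ∈ Finset.range k, t ^ j * k :=
          Finset.sum_le_sum fun j hj => Nat.mul_le_mul_left _ (Finset.mem_range.1 hj).le
      _ = (∑ j ∈ Finset.range k, t ^ j) * k := by rw [Finset.sum_mul]
      _ ≤ _ := Nat.mul_le_mul_right _ h1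
  · have := Finset.sum_le_card_nsmul (Finset.range (m + 1)) (fun j => t ^ k * (k + j))
      (t ^ k * (k + m)) (fun j hj => Nat.mul_le_mul_left _ (by
        have := Finset.mem_range.1 hj; omega))
    refine this.trans (le_of_eq ?_)
    simp; ring

theorem base_lower (t k m : ℕ) : t ^ k * (k * (m + 1)) ≤ TAry.base t k m := by
  unfold TAry.base
  refine le_trans ?_ (Nat.le_add_left _ _)
  have := Finset.card_nsmul_le_sum (Finset.range (m + 1)) (fun j => t ^ k * (k + j))
      (t ^ k * k) (fun j hj => Nat.mul_le_mul_left _ (by omega))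
  refine le_trans (le_of_eq ?_) this
  simp; ring

theorem base_succ (t k m : ℕ) : TAry.base t k (m + 1) = TAry.base t k m + t ^ k * (k + m + 1) := by
  unfold TAry.base
  rw [Finset.sum_range_succ _ (m + 1)]; ring

set_option maxHeartbeats 1000000 in
theorem params (t K : ℕ) (ht : 2 ≤ t) (hK1 : 1 ≤ K)
    (hK : ∀ k, K ≤ k → 10000 * t ^ 2 * k ^ 2 ≤ t ^ k) (p : ℕ)
    (hp : TAry.base t K K.sqrt + 2 * (K + K.sqrt + 1) ^ 2 ≤ p) :
    ∃ k m, K ≤ k ∧ k.sqrt ≤ m ∧ m ≤ 16 * t * k.sqrt ∧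
      (t * t ^ k).choose (t ^ k) ^ m ≤ Tt t p ∧ p ≤ t ^ k * ((m + 4) * (k + m + 1)) ∧
      t ^ k * k ≤ p ∧ p ≤ t ^ (3 * k) := by
  obtain ⟨k, hKk, hk1, hk2⟩ := exists_between_steps
    (fun k => TAry.base t k k.sqrt + 2 * (k + k.sqrt + 1) ^ 2) K p (fun n => by
      have := Nat.le_self_pow two_ne_zero (n + n.sqrt + 1); omega) hp
  obtain ⟨m, hsm, hm1, hm2⟩ := exists_between_steps
    (fun m => TAry.base t k m + 2 * (k + m + 1) ^ 2) k.sqrt p (fun n => by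
      have := Nat.le_self_pow two_ne_zero (k + n + 1); omega) hk1
  have hL := hK k hKk
  set s := k.sqrt with hs
  set L := t ^ k with hLdef
  have hk : 1 ≤ k := hK1.trans hKk
  have hs1 : 1 ≤ s := Nat.le_sqrt.2 (by omega)
  have hsk : s ≤ k := Nat.sqrt_le_self k
  have hs' : (k + 1).sqrt ≤ s + 1 := Nat.sqrt_succ_le_succ_sqrt k
  have hlow := base_lower t k m
  rw [← hLdef] at hlow
  have hLpos : 0 < L := by positivity
  have htk : t * k ≤ t ^ 2 * k ^ 2 := by
    rw [← mul_pow]; exact Nat.le_self_pow (by norm_num) _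
  have hkk : k ^ 2 ≤ t ^ 2 * k ^ 2 := Nat.le_mul_of_pos_left _ (by positivity)
  -- upper bound for m
  have hm : m ≤ 16 * t * s := by
    have hup := base_upper t (k + 1) ((k + 1).sqrt) ht
    rw [pow_succ, ← hLdef] at hup
    have e1 : ((k + 1).sqrt + 1) * (k + 1 + (k + 1).sqrt) ≤ (s + 2) * (k + s + 2) :=
      Nat.mul_le_mul (by omega) (by omega)
    have e2 : 2 * (k + 1 + (k + 1).sqrt + 1) ^ 2 ≤ L := by
      have : 2 * (k + 1 + (k + 1).sqrt + 1) ^ 2 ≤ 2 * (5 * k) ^ 2 := by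
        gcongr; omega
      nlinarith
    have e3 : p ≤ L * t * ((k + 1) + (s + 2) * (k + s + 2) + 1) := by
      have e4 : L * t * (((k + 1).sqrt + 1) * (k + 1 + (k + 1).sqrt)) ≤
        L * t * ((s + 2) * (k + s + 2)) := Nat.mul_le_mul_left _ e1
      have e5 : L ≤ L * t := Nat.le_mul_of_pos_right _ (by omega)
      nlinarith
    have e6 : (k + 1) + (s + 2) * (k + s + 2) + 1 ≤ 4 * s * (4 * k) := by
      have : (k + 1) + (s + 2) * (k + s + 2) + 1 ≤ (s + 3) * (k + s + 2) := by nlinarith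
      exact this.trans (Nat.mul_le_mul (by omega) (by omega))
    have e7 : L * (k * (m + 1)) ≤ L * (k * (16 * t * s)) := by
      calc L * (k * (m + 1)) ≤ p := by omega
        _ ≤ L * t * (4 * s * (4 * k)) := e3.trans (Nat.mul_le_mul_left _ e6)
        _ = _ := by ring
    have e8 := Nat.le_of_mul_le_mul_left (Nat.le_of_mul_le_mul_left e7 hLpos) hk
    omega
  have hmk : m ≤ 16 * (t * k) := by
    refine hm.trans ?_
    rw [mul_assoc]; gcongr
  have hktk : k ≤ t * k := Nat.le_mul_of_pos_left _ (by omega)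
  set e := k + m + 1 with he
  have he1 : e ≤ 18 * (t * k) := by omega
  have he2 : 8 * e ≤ L := by nlinarith
  have he3 : 2 * (k + (m + 1) + 1) ^ 2 ≤ L * e := by
    have : 2 * (k + (m + 1) + 1) ^ 2 ≤ 2 * (2 * e) ^ 2 := by
      gcongr; omega
    nlinarith
  have hbs := base_succ t k m
  rw [← hLdef, ← he] at hbs
  have hpup : p ≤ TAry.base t k m + 2 * L * e := by linarith
  have hpup2 : p ≤ L * ((m + 4) * e) := by
    have := base_upper t k m ht
    rw [← hLdef] at this
    have e1 : (m + 1) * (k + m) ≤ (m + 1) * e := Nat.mul_le_mul_left _ (by omega)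
    have e2 : k ≤ e := by omega
    have : TAry.base t k m ≤ L * e + L * ((m + 1) * e) := this.trans (by gcongr)
    calc p ≤ _ := hpup
      _ ≤ L * e + L * ((m + 1) * e) + 2 * L * e := by omega
      _ = _ := by ring
  refine ⟨k, m, hKk, hsm, hm, TAry.main_count t k m p ht hm1 hpup, hpup2, ?_, ?_⟩
  · have : L * k ≤ L * (k * (m + 1)) := Nat.mul_le_mul_left _ (Nat.le_mul_of_pos_right _ (by omega))
    exact this.trans (hlow.trans ((Nat.le_add_right _ _).trans hm1))
  · rw [mul_comm 3, pow_mul, ← hLdef]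
    refine hpup2.trans ?_
    rw [pow_succ', pow_two]
    exact Nat.mul_le_mul_left _ (Nat.mul_le_mul (by omega) (by omega))

theorem exists_K (t : ℕ) (ht : 2 ≤ t) :
    ∃ K, 1 ≤ K ∧ ∀ k, K ≤ k → 10000 * t ^ 2 * k ^ 2 ≤ t ^ k := by
  have h := tendsto_pow_const_div_const_pow_of_one_lt 2 (r := (t : ℝ)) (by exact_mod_cast ht)
  have hpos : (0 : ℝ) < 1 / (10000 * t ^ 2) := by positivity
  have h2 := (h.eventually (gt_mem_nhds hpos)).and (Filter.eventually_ge_atTop 1)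
  obtain ⟨K, hK⟩ := Filter.eventually_atTop.1 h2
  refine ⟨max K 1, le_max_right _ _, fun k hk => ?_⟩
  have h3 := (hK k ((le_max_left _ _).trans hk)).1
  rw [div_lt_div_iff₀ (by positivity) (by positivity)] at h3
  have : (10000 * t ^ 2 * k ^ 2 : ℝ) ≤ t ^ k := by linarith
  exact_mod_cast this

theorem binEnt_mul (t : ℕ) (ht : 2 ≤ t) :
    binEnt (1 / t) * t = t * Real.log t - (t - 1) * Real.log (t - 1) := by
  have h2 : (2 : ℝ) ≤ t := by exact_mod_cast ht
  have h0 : (t : ℝ) ≠ 0 := by positivity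
  have h1 : (t : ℝ) - 1 ≠ 0 := by linarith
  unfold binEnt
  rw [show (1 : ℝ) - 1 / t = (t - 1) / t by field_simp, Real.log_div h1 h0,
    Real.log_div one_ne_zero h0, Real.log_one]
  field_simp
  ring

theorem log_choose (t k : ℕ) (ht : 2 ≤ t) :
    binEnt (1 / t) * t * (t : ℝ) ^ k - (k + 2) * Real.log t ≤
      Real.log ((t * t ^ k).choose (t ^ k)) := by
  have h2 : (2 : ℝ) ≤ t := by exact_mod_cast ht
  obtain ⟨u, rfl⟩ : ∃ u, t = u + 1 := ⟨t - 1, by omega⟩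
  have hu : (1 : ℝ) ≤ u := by push_cast at h2; linarith
  rw [binEnt_mul _ ht]
  set L := (u + 1) ^ k with hL
  have hLr : (((u + 1 : ℕ) : ℝ)) ^ k = L := by rw [hL]; push_cast; rfl
  rw [hLr]
  have hb := choose_bound u L
  have hLpos : 1 ≤ L := Nat.one_le_pow _ _ (by omega)
  have hn : (u + 1) * L + 1 ≤ (u + 1) ^ (k + 2) := by
    rw [pow_add, ← hL]
    have h4 : L * ((u + 1) * 2) ≤ L * ((u + 1) * (u + 1)) := by gcongr
    have h5 : L ≤ (u + 1) * L := Nat.le_mul_of_pos_left _ (by omega)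
    nlinarith
  have hb2 := hb.trans (Nat.mul_le_mul_right _ hn)
  have hb3 : (((u + 1 : ℕ) : ℝ)) ^ ((u + 1) * L) ≤
      ((u + 1 : ℕ) : ℝ) ^ (k + 2) * ((((u + 1) * L).choose L : ℕ) * (u : ℝ) ^ (u * L)) := by
    exact_mod_cast hb2
  have hc : (0 : ℝ) < (((u + 1) * L).choose L : ℕ) := by
    exact_mod_cast Nat.choose_pos (Nat.le_mul_of_pos_left _ (by omega))
  have hl := Real.log_le_log (by positivity) hb3
  rw [Real.log_mul (by positivity) (by positivity), Real.log_mul (by positivity) (by positivity),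
    Real.log_pow, Real.log_pow, Real.log_pow] at hl
  have : ((u + 1 : ℕ) : ℝ) - 1 = u := by push_cast; ring
  rw [this]
  push_cast at hl ⊢
  nlinarith

theorem H_ge (t : ℕ) (ht : 2 ≤ t) : Real.log t ≤ binEnt (1 / t) * t := by
  rw [binEnt_mul t ht]
  have h2 : (2 : ℝ) ≤ t := by exact_mod_cast ht
  have : Real.log (t - 1) ≤ Real.log t := Real.log_le_log (by linarith) (by linarith)
  nlinarith

set_option maxHeartbeats 1000000 in
/-- `log T_t(p) ≥ (α p / log p)(1 - O((log p)^{-1/2}))` with `α = h(1/t) t log t`. -/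
theorem stmt13 (t : ℕ) (ht : 2 ≤ t) :
    ∃ c : ℝ, ∃ P₀ : ℕ, ∀ p : ℕ, P₀ ≤ p →
      (binEnt (1 / t) * t * Real.log t) * p / Real.log p *
          (1 - c * (Real.log p) ^ (-(1 / 2) : ℝ)) ≤ Real.log (Tt t p) := by
  obtain ⟨K, hK1, hK⟩ := exists_K t ht
  have h2 : (2 : ℝ) ≤ t := by exact_mod_cast ht
  have hlogt : 0 < Real.log t := Real.log_pos (by linarith)
  refine ⟨(9 + 189 * t) * √(3 * Real.log t), TAry.base t K K.sqrt + 2 * (K + K.sqrt + 1) ^ 2,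
    fun p hp => ?_⟩
  obtain ⟨k, m, hKk, hsm, hms, hcount, hp1, hp2, hp3⟩ := params t K ht hK1 hK p hp
  have hKk' := hK k hKk
  have hH := H_ge t ht
  have hch := log_choose t k ht
  set H := binEnt (1 / t) * t with hHdef
  set lt := Real.log t with hlt
  have hHpos : 0 < H := hlogt.trans_le hH
  have hk : 1 ≤ k := hK1.trans hKk
  set C := (t * t ^ k).choose (t ^ k) with hC
  have hCpos : 0 < C := Nat.choose_pos (Nat.le_mul_of_pos_left _ (by omega))
  have hLHS0 : (0 : ℝ) ≤ Real.log (Tt t p) := Real.log_natCast_nonneg _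
  -- log T ≥ m log C
  have hlogT : m * Real.log C ≤ Real.log (Tt t p) := by
    rw [← Real.log_pow]
    refine Real.log_le_log (by positivity) ?_
    exact_mod_cast hcount
  -- x = sqrt k
  set x := √(k : ℝ) with hx
  have hkr : (1 : ℝ) ≤ k := by exact_mod_cast hk
  have hxx : x * x = k := Real.mul_self_sqrt (by positivity)
  have hx1 : 1 ≤ x := Real.one_le_sqrt.2 hkr
  have hsx : (k.sqrt : ℝ) ≤ x := Real.nat_sqrt_le_real_sqrt
  have hxs : x ≤ k.sqrt + 1 := Real.real_sqrt_le_nat_sqrt_succ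
  have hs1 : (1 : ℝ) ≤ k.sqrt := by exact_mod_cast Nat.le_sqrt.2 (by omega)
  have hmx : x ≤ 2 * m := by
    have : (k.sqrt : ℝ) ≤ m := by exact_mod_cast hsm
    linarith
  have hmx2 : (m : ℝ) ≤ 16 * t * x := by
    have : (m : ℝ) ≤ 16 * t * k.sqrt := by exact_mod_cast hms
    refine this.trans ?_
    gcongr
  have hmpos : (0 : ℝ) < m := by linarith
  set L := (t : ℝ) ^ k with hL
  have hLpos : 0 < L := by positivity
  have hp1r : (p : ℝ) ≤ L * ((m + 4) * (k + m + 1)) := by rw [hL]; exact_mod_cast hp1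
  have hp2r : L * k ≤ (p : ℝ) := by rw [hL]; exact_mod_cast hp2
  have hp3r : (p : ℝ) ≤ (t : ℝ) ^ (3 * k) := by exact_mod_cast hp3
  have hppos : (0 : ℝ) < p := lt_of_lt_of_le (by positivity) hp2r
  set l := Real.log p with hl
  have hl1 : k * lt ≤ l := by
    have : L ≤ p := le_trans (by nlinarith) hp2r
    have := Real.log_le_log hLpos this
    rwa [hL, Real.log_pow] at this
  have hl2 : l ≤ 3 * k * lt := by
    have := Real.log_le_log hppos hp3r
    rw [Real.log_pow] at this
    push_cast at this
    exact this
  have hlpos : 0 < l := lt_of_lt_of_le (by positivity) hl1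
  -- the error factor
  have hrp : l ^ (-(1 / 2) : ℝ) = (√l)⁻¹ := by
    rw [Real.rpow_neg hlpos.le, Real.sqrt_eq_rpow]
  rw [hrp]
  set A : ℝ := 8 + 189 * t with hA
  have hApos : 0 < A := by positivity
  have hsq : √l ≤ √(3 * lt) * x := by
    rw [hx, ← Real.sqrt_mul (by positivity)]
    exact Real.sqrt_le_sqrt (by linarith)
  have hslpos : 0 < √l := Real.sqrt_pos.2 hlpos
  have hF : 1 - (9 + 189 * t) * √(3 * lt) * (√l)⁻¹ ≤ 1 - (A + 1) / x := by
    have : (A + 1) / x ≤ (9 + 189 * t) * √(3 * lt) * (√l)⁻¹ := by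
      rw [← div_eq_mul_inv, div_le_div_iff₀ (by positivity) hslpos]
      have : (9 : ℝ) + 189 * t = A + 1 := by rw [hA]; ring
      rw [this, mul_assoc]
      gcongr
    linarith
  set F := 1 - (9 + 189 * t) * √(3 * lt) * (√l)⁻¹ with hFdef
  have hmain : H * lt * p / l ≤ H * L * m * (1 + A / x) := by
    have e1 : H * lt * p / l ≤ H * lt * p / (k * lt) := by gcongr
    have e2 : H * lt * p / (k * lt) = H * p / k := by field_simp
    have e3 : H * p / k ≤ H * (L * ((m + 4) * (k + m + 1))) / k := by gcongr
    have e4 : ((m : ℝ) + 4) * (k + m + 1) / k ≤ m * (1 + A / x) := by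
      have a1 : (m : ℝ) + 4 ≤ m * (1 + 8 / x) := by
        have : 4 ≤ m * (8 / x) := by
          rw [mul_div_assoc', le_div_iff₀ (by positivity)]; linarith
        linarith
      have a2 : ((k : ℝ) + m + 1) / k ≤ 1 + 21 * t / x := by
        rw [div_le_iff₀ (by positivity), ← hxx]
        have : (1 + 21 * t / x) * (x * x) = x * x + 21 * t * x := by field_simp
        rw [this]
        nlinarith
      have a3 : (1 + 8 / x) * (1 + 21 * t / x) ≤ 1 + A / x := by
        have b1 : (1 + 8 / x) * (1 + 21 * t / x) = 1 + (8 + 21 * t) / x + (168 * t / x) / x := by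
          field_simp; ring
        have b2 : (168 * t / x) / x ≤ 168 * t / x := div_le_self (by positivity) hx1
        have b3 : A / x = (8 + 21 * t) / x + 168 * t / x := by rw [hA]; ring
        linarith
      calc ((m : ℝ) + 4) * (k + m + 1) / k = (m + 4) * ((k + m + 1) / k) := by ring
        _ ≤ (m * (1 + 8 / x)) * (1 + 21 * t / x) := by gcongr
        _ = m * ((1 + 8 / x) * (1 + 21 * t / x)) := by ring
        _ ≤ _ := by gcongr
    calc H * lt * p / l ≤ H * (L * ((m + 4) * (k + m + 1))) / k := by linarith
      _ = H * L * (((m : ℝ) + 4) * (k + m + 1) / k) := by ring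
      _ ≤ H * L * (m * (1 + A / x)) := by gcongr
      _ = _ := by ring
  have hX : 0 ≤ H * lt * p / l := by positivity
  rcases le_total F 0 with hF0 | hF0
  · exact (mul_nonpos_of_nonneg_of_nonpos hX hF0).trans hLHS0
  have hfin : H * L * m * (1 - 1 / x) ≤ m * Real.log C := by
    have c1 : (k + 2) * lt ≤ H * L / x := by
      rw [le_div_iff₀ (by positivity)]
      have d1 : (10000 * t ^ 2 * k ^ 2 : ℝ) ≤ L := by rw [hL]; exact_mod_cast hKk'
      have d2 : (k + 2) * x ≤ L := by
        have d3 : x ≤ k := by nlinarith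
        have d4 : (k + 2) * x ≤ (3 * k) * k := by
          have : (k : ℝ) + 2 ≤ 3 * k := by linarith
          gcongr
        have d5 : (1 : ℝ) ≤ t ^ 2 := by nlinarith
        have d6 : (k : ℝ) ^ 2 ≤ t ^ 2 * k ^ 2 := by nlinarith [sq_nonneg (k : ℝ)]
        nlinarith
      calc (k + 2) * lt * x = lt * ((k + 2) * x) := by ring
        _ ≤ H * L := by gcongr
    calc H * L * m * (1 - 1 / x) = m * (H * L - H * L / x) := by ring
      _ ≤ m * Real.log C := by
        gcongr
        linarith
  calc H * lt * p / l * F ≤ (H * L * m * (1 + A / x)) * (1 - (A + 1) / x) := by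
        gcongr
    _ ≤ H * L * m * (1 - 1 / x) := by
        rw [mul_assoc]
        gcongr
        have : (1 + A / x) * (1 - (A + 1) / x) = 1 - 1 / x - (A / x) * ((A + 1) / x) := by
          ring
        rw [this]
        have : 0 ≤ (A / x) * ((A + 1) / x) := by positivity
        linarith
    _ ≤ _ := hfin.trans hlogT
end

section
/- The number of t-ary trees with path length equal to p is exp(h(1/t)·t·log t · (p/log p) · (1+o(1))) as p → ∞. -/
namespace TAry
open Classical Filter Topology

variable {t : ℕ}

/-- Trees of height at most `H`. -/
noncomputable def treesH (t : ℕ) : ℕ → Finset (TAry t)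
  | 0 => {nil}
  | H + 1 => insert nil ((Fintype.piFinset (fun _ : Fin t => treesH t H)).image node)

theorem node_inj : Function.Injective (node : (Fin t → TAry t) → TAry t) := by
  intro a b h
  injection h

theorem mem_treesH_succ {H : ℕ} {c : Fin t → TAry t} :
    node c ∈ treesH t (H + 1) ↔ ∀ i, c i ∈ treesH t H := by
  simp [treesH, Fintype.mem_piFinset]

theorem nil_mem_treesH (H : ℕ) : (nil : TAry t) ∈ treesH t H := by
  cases H <;> simp [treesH]

theorem mem_treesH (T : TAry t) : ∀ H, T.size ≤ H → T ∈ treesH t H := by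
  induction T with
  | nil => intro H _; exact nil_mem_treesH H
  | node c ih =>
    intro H h
    simp only [size] at h
    obtain ⟨H, rfl⟩ : ∃ K, H = K + 1 := ⟨H - 1, by omega⟩
    rw [mem_treesH_succ]
    intro i
    apply ih
    have := Finset.single_le_sum (f := fun i => (c i).size) (fun _ _ => Nat.zero_le _)
      (Finset.mem_univ i)
    omega

theorem plFrom_eq (T : TAry t) : ∀ d, T.plFrom d = T.plFrom 0 + d * T.size := by
  induction T with
  | nil => intro d; simp [plFrom, size]
  | node c ih =>
    intro d
    simp only [plFrom, size]
    have h1 : ∀ i, (c i).plFrom (d + 1) = (c i).plFrom (0 + 1) + d * (c i).size := by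
      intro i
      rw [ih i (d + 1), ih i (0 + 1)]; ring
    simp only [h1, Finset.sum_add_distrib, ← Finset.mul_sum]
    ring

theorem plFrom_le (H : ℕ) : ∀ (T : TAry t), T ∈ treesH t H → ∀ d, T.plFrom d ≤ (d + H) * T.size := by
  induction H with
  | zero =>
    intro T hT d
    simp [treesH] at hT
    subst hT
    simp [plFrom]
  | succ H ih =>
    intro T hT d
    cases T with
    | nil => simp [plFrom]
    | node c =>
      rw [mem_treesH_succ] at hT
      simp only [plFrom, size]
      have : ∑ i, (c i).plFrom (d + 1) ≤ ∑ i, (d + 1 + H) * (c i).size :=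
        Finset.sum_le_sum fun i _ => ih _ (hT i) _
      rw [← Finset.mul_sum] at this
      nlinarith

/-- The constants in the path length lower bound. -/
def cc (t : ℕ) : ℕ → ℕ
  | 0 => 0
  | k + 1 => t * cc t k + (k + 1)

theorem cc_le (ht : 2 ≤ t) (k : ℕ) : cc t k + k + 2 ≤ 2 * t ^ k := by
  induction k with
  | zero => simp [cc]
  | succ k ih =>
    simp only [cc, pow_succ]
    have := Nat.mul_le_mul_left t ih
    nlinarith

theorem size_mul_le (T : TAry t) : ∀ k, T.size * k ≤ T.plFrom 0 + cc t k := by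
  induction T with
  | nil => intro k; simp [size]
  | node c ih =>
    intro k
    cases k with
    | zero => simp
    | succ k =>
      simp only [size, plFrom, cc]
      have h1 : ∀ i, (c i).plFrom (0 + 1) = (c i).plFrom 0 + (c i).size := by
        intro i
        rw [plFrom_eq]; ring
      simp only [h1, Finset.sum_add_distrib]
      have h2 : ∑ i, (c i).size * k ≤ ∑ i, ((c i).plFrom 0 + cc t k) :=
        Finset.sum_le_sum fun i _ => ih i k
      rw [← Finset.sum_mul, Finset.sum_add_distrib] at h2
      simp at h2
      nlinarith

theorem size_le_of_pathLength {T : TAry t} {p : ℕ} (h : T.pathLength = p) : T.size ≤ p + 1 := by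
  have := size_mul_le T 1
  simp [cc] at this
  simp only [pathLength] at h
  omega

theorem Tt_eq (p : ℕ) : Tt t p = ((treesH t (p + 1)).filter (fun T => T.pathLength = p)).card := by
  unfold Tt
  rw [Nat.subtype_card]
  intro T
  simp only [Finset.mem_filter, and_iff_right_iff_imp]
  intro h
  exact mem_treesH _ _ (size_le_of_pathLength h)

theorem card_le_Tt {p : ℕ} (S : Finset (TAry t)) (hS : ∀ T ∈ S, T.pathLength = p) :
    S.card ≤ Tt t p := by
  rw [Tt_eq]
  apply Finset.card_le_card
  intro T hT
  simp only [Finset.mem_filter]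
  exact ⟨mem_treesH _ _ (size_le_of_pathLength (hS T hT)), hS T hT⟩

/-! ### Generating functions -/

/-- Generating function of trees of bounded height. -/
noncomputable def GH (t H : ℕ) (x : ℝ) : ℝ := ∑ T ∈ treesH t H, x ^ T.size

theorem GH_succ (H : ℕ) (x : ℝ) : GH t (H + 1) x = 1 + x * (GH t H x) ^ t := by
  unfold GH
  rw [treesH, Finset.sum_insert (by simp), Finset.sum_image (by intro a _ b _ h; exact node_inj h)]
  have : (∑ T ∈ treesH t H, x ^ T.size) ^ t = ∏ _i : Fin t, ∑ T ∈ treesH t H, x ^ T.size := by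
    simp
  rw [this, Finset.prod_univ_sum]
  simp only [size, pow_zero, pow_add, pow_one, Finset.prod_pow_eq_pow_sum, Finset.mul_sum]

theorem GH_zero (x : ℝ) : GH t 0 x = 1 := by simp [GH, treesH, size]

/-- growth constant -/
noncomputable def cst (t : ℕ) : ℝ := binEnt (1 / t) * t

theorem cst_eq (ht : 2 ≤ t) :
    cst t = Real.log t + (t - 1) * (Real.log t - Real.log (t - 1)) := by
  have h2 : (2 : ℝ) ≤ t := by exact_mod_cast ht
  have h1 : (1 - 1 / (t : ℝ)) = (t - 1) / t := by field_simp
  unfold cst binEnt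
  rw [h1, one_div, Real.log_inv, Real.log_div (by linarith) (by linarith)]
  field_simp
  ring

theorem cst_pos (ht : 2 ≤ t) : 0 < cst t := by
  have h2 : (2 : ℝ) ≤ t := by exact_mod_cast ht
  rw [cst_eq ht]
  have h3 : 0 < Real.log t := Real.log_pos (by linarith)
  have h4 : Real.log (t - 1) ≤ Real.log t := Real.log_le_log (by linarith) (by linarith)
  have : 0 ≤ ((t : ℝ) - 1) * (Real.log t - Real.log (t - 1)) :=
    mul_nonneg (by linarith) (by linarith)
  linarith

theorem xz (ht : 2 ≤ t) : Real.exp (-cst t) * ((t : ℝ) / (t - 1)) ^ t = 1 / (t - 1) := by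
  have h2 : (2 : ℝ) ≤ t := by exact_mod_cast ht
  have hz : (0 : ℝ) < t / (t - 1) := div_pos (by linarith) (by linarith)
  have hp : (0 : ℝ) < 1 / (t - 1) := by apply one_div_pos.mpr; linarith
  rw [← Real.exp_log (pow_pos hz t), ← Real.exp_add, ← Real.exp_log hp]
  congr 1
  rw [cst_eq ht, Real.log_pow, Real.log_div (by linarith) (by linarith), one_div, Real.log_inv]
  ring

theorem GH_le (ht : 2 ≤ t) (H : ℕ) : GH t H (Real.exp (-cst t)) ≤ 2 := by
  have h2 : (2 : ℝ) ≤ t := by exact_mod_cast ht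
  have key : GH t H (Real.exp (-cst t)) ≤ t / (t - 1) := by
    induction H with
    | zero =>
      rw [GH_zero, le_div_iff₀ (by linarith)]; linarith
    | succ H ih =>
      rw [GH_succ]
      have h0 : 0 ≤ GH t H (Real.exp (-cst t)) := Finset.sum_nonneg fun _ _ => by positivity
      calc _ ≤ 1 + Real.exp (-cst t) * ((t : ℝ) / (t - 1)) ^ t := by gcongr
        _ = 1 + 1 / (t - 1) := by rw [xz ht]
        _ = t / (t - 1) := by
          have : (t : ℝ) - 1 ≠ 0 := by linarith
          field_simp
          ring
  refine key.trans ?_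
  rw [div_le_iff₀ (by linarith)]
  linarith

theorem tangent (ht : 2 ≤ t) (z : ℝ) (hz : 0 ≤ z) : z ≤ 1 + Real.exp (-cst t) * z ^ t := by
  have h2 : (2 : ℝ) ≤ t := by exact_mod_cast ht
  have h1 : (0 : ℝ) < t - 1 := by linarith
  set u := z * ((t - 1) / t) with hu
  have hu0 : 0 ≤ u := by positivity
  have hzu : z = t / (t - 1) * u := by rw [hu]; field_simp
  have hb := one_add_mul_le_pow (a := u - 1) (by linarith) t
  have : Real.exp (-cst t) * z ^ t = 1 / (t - 1) * u ^ t := by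
    rw [hzu, mul_pow, ← mul_assoc, xz ht]
  rw [this, hzu]
  rw [add_sub_cancel] at hb
  have : t / (t - 1) * u = 1 + 1 / (t - 1) * (1 + t * (u - 1)) := by field_simp; ring
  rw [this]
  gcongr

theorem GH_ge (ht : 2 ≤ t) {x : ℝ} (hx : Real.exp (-cst t) ≤ x) (H : ℕ) :
    1 + H * (x - Real.exp (-cst t)) ≤ GH t H x := by
  induction H with
  | zero => simp [GH_zero]
  | succ H ih =>
    rw [GH_succ]
    set z := GH t H x
    have hz1 : 1 ≤ z := by
      have : 0 ≤ (H : ℝ) * (x - Real.exp (-cst t)) := mul_nonneg (by positivity) (by linarith)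
      linarith
    have h1 := tangent ht z (by linarith)
    have h2 : (1 : ℝ) ≤ z ^ t := one_le_pow₀ hz1
    push_cast
    nlinarith

/-- Trees with exactly `m` nodes. -/
noncomputable def fam (t m : ℕ) : Finset (TAry t) := (treesH t m).filter (fun T => T.size = m)

theorem exists_m (ht : 2 ≤ t) {η : ℝ} (hη : η < cst t) (M : ℕ) :
    ∃ m, M ≤ m ∧ Real.exp (η * m) ≤ (fam t m).card := by
  by_contra! hcon
  set x := Real.exp (-((η + cst t) / 2)) with hx
  have hx1 : Real.exp (-cst t) < x := Real.exp_lt_exp.mpr (by linarith)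
  have hx0 : 0 < x := Real.exp_pos _
  have hs : Summable (fun n : ℕ => ((fam t n).card : ℝ) * x ^ n) := by
    have hg : Summable (fun n : ℕ => (Real.exp ((η - cst t) / 2)) ^ n) :=
      summable_geometric_of_lt_one (Real.exp_pos _).le (Real.exp_lt_one_iff.mpr (by linarith))
    refine Summable.of_norm_bounded_eventually_nat hg ?_
    filter_upwards [eventually_ge_atTop M] with n hn
    rw [Real.norm_of_nonneg (by positivity)]
    calc ((fam t n).card : ℝ) * x ^ n ≤ Real.exp (η * n) * x ^ n := by
          gcongr
          exact (hcon n hn).le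
      _ = _ := by
        rw [hx, ← Real.exp_nat_mul, ← Real.exp_nat_mul, ← Real.exp_add]
        congr 1
        ring
  have hb : ∀ H, GH t H x ≤ ∑' n, ((fam t n).card : ℝ) * x ^ n := by
    intro H
    have h1 : GH t H x ≤ ∑ n ∈ (treesH t H).image size, ((fam t n).card : ℝ) * x ^ n := by
      unfold GH
      rw [← Finset.sum_fiberwise_of_maps_to (s := treesH t H) (t := (treesH t H).image size)
        (g := size) (fun T hT => Finset.mem_image_of_mem _ hT)]
      apply Finset.sum_le_sum
      intro n _
      calc ∑ T ∈ treesH t H with T.size = n, x ^ T.size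
          = ∑ T ∈ treesH t H with T.size = n, x ^ n :=
            Finset.sum_congr rfl (fun T hT => by rw [(Finset.mem_filter.mp hT).2])
        _ = (((treesH t H).filter (fun T => T.size = n)).card : ℝ) * x ^ n := by simp
        _ ≤ _ := by
          gcongr
          intro T hT
          have := (Finset.mem_filter.mp hT).2
          exact Finset.mem_filter.mpr ⟨mem_treesH _ _ this.le, this⟩
    exact h1.trans (hs.sum_le_tsum _ (fun n _ => by positivity))
  obtain ⟨H, hH⟩ := exists_nat_gt
    ((∑' n, ((fam t n).card : ℝ) * x ^ n) / (x - Real.exp (-cst t)))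
  rw [div_lt_iff₀ (by linarith)] at hH
  have := GH_ge ht hx1.le H
  have := hb H
  linarith

/-! ### Constructions -/

theorem split (n : ℕ) : ∀ (q M : ℕ), q ≤ n * M → ∃ f : Fin n → ℕ, (∀ i, f i ≤ M) ∧ ∑ i, f i = q := by
  induction n with
  | zero => intro q M h; exact ⟨fun _ => 0, by simp, by simp at h; simp [h]⟩
  | succ n ih =>
    intro q M h
    obtain ⟨f, hf, hs⟩ := ih (q - min q M) M (by rw [Nat.succ_mul] at h; omega)
    refine ⟨Fin.cons (min q M) f, ?_, ?_⟩
    · intro i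
      refine Fin.cases ?_ ?_ i
      · simp
      · simpa using hf
    · rw [Fin.sum_univ_succ]
      simp [hs]

theorem exists_family (ht : 2 ≤ t) (m k : ℕ) : ∀ q ≤ t ^ k, ∃ S : Finset (TAry t),
    S.card = (fam t m).card ^ q ∧ ∀ T ∈ S, T ∈ treesH t (k + m) ∧ T.size + 1 ≤ t ^ k + q * m := by
  induction k with
  | zero =>
    intro q hq
    have : q = 0 ∨ q = 1 := by simp at hq; omega
    rcases this with rfl | rfl
    · refine ⟨{nil}, by simp, ?_⟩
      intro T hT
      simp at hT
      subst hT
      exact ⟨nil_mem_treesH _, by simp [size]⟩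
    · refine ⟨fam t m, by simp, ?_⟩
      intro T hT
      have := Finset.mem_filter.mp hT
      refine ⟨by simpa using this.1, by have := this.2; simp; omega⟩
  | succ k ih =>
    intro q hq
    obtain ⟨f, hf, hs⟩ := split t q (t ^ k) (by rw [pow_succ] at hq; linarith)
    choose S hS1 hS2 using fun i => ih (f i) (hf i)
    refine ⟨(Fintype.piFinset S).image node, ?_, ?_⟩
    · rw [Finset.card_image_of_injective _ node_inj, Fintype.card_piFinset]
      simp only [hS1]
      rw [Finset.prod_pow_eq_pow_sum, hs]
    · intro T hT
      obtain ⟨c, hc, rfl⟩ := Finset.mem_image.mp hT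
      rw [Fintype.mem_piFinset] at hc
      constructor
      · rw [show k + 1 + m = (k + m) + 1 by ring, mem_treesH_succ]
        exact fun i => (hS2 i _ (hc i)).1
      · have h1 : ∑ i, ((c i).size + 1) ≤ ∑ i, (t ^ k + f i * m) :=
          Finset.sum_le_sum fun i _ => (hS2 i _ (hc i)).2
        rw [Finset.sum_add_distrib, Finset.sum_add_distrib, ← Finset.sum_mul, hs] at h1
        simp at h1
        simp only [size, pow_succ]
        linarith

/-- A node with two prescribed children. -/
def two (t : ℕ) (A B : TAry t) : TAry t :=
  node (fun i => if i.val = 0 then A else if i.val = 1 then B else nil)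

theorem plFrom_two (ht : 2 ≤ t) (A B : TAry t) (d : ℕ) :
    (two t A B).plFrom d = d + (A.plFrom (d + 1) + B.plFrom (d + 1)) := by
  obtain ⟨s, rfl⟩ : ∃ s, t = s + 2 := ⟨t - 2, by omega⟩
  simp only [two, plFrom]
  rw [Fin.sum_univ_succ, Fin.sum_univ_succ]
  simp [plFrom]

theorem two_inj (ht : 2 ≤ t) {A A' B B' : TAry t} (h : two t A B = two t A' B') : A = A' := by
  have := congrFun (node_inj h) ⟨0, by omega⟩
  simpa using this

/-- sum of depths of a chain with `d + 1` nodes starting at depth `e` -/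
def ch (e : ℕ) : ℕ → ℕ
  | 0 => e
  | d + 1 => ch e d + (e + d + 1)

theorem ch_succ' (e d : ℕ) : ch e (d + 1) = e + ch (e + 1) d := by
  induction d with
  | zero => simp [ch]
  | succ d ih => rw [ch, ih, ch]; ring

theorem chain_extra (ht : 2 ≤ t) (d : ℕ) : ∀ e x, (x = 0 ∨ e + 1 ≤ x ∧ x ≤ e + d) →
    ∃ T : TAry t, T.plFrom e = ch e d + x := by
  induction d with
  | zero =>
    intro e x hx
    have : x = 0 := by omega
    subst this
    exact ⟨two t nil nil, by rw [plFrom_two ht]; simp [plFrom, ch]⟩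
  | succ d ih =>
    intro e x hx
    by_cases h : x = e + 1
    · obtain ⟨T, hT⟩ := ih (e + 1) 0 (Or.inl rfl)
      refine ⟨two t T (two t nil nil), ?_⟩
      rw [plFrom_two ht, plFrom_two ht, hT, ch_succ', h]
      simp [plFrom]
      ring
    · obtain ⟨T, hT⟩ := ih (e + 1) x (by omega)
      refine ⟨two t T nil, ?_⟩
      rw [plFrom_two ht, hT, ch_succ']
      simp [plFrom]
      ring

theorem exists_ch (e f r : ℕ) (h : ch e f ≤ r) : ∃ d, f ≤ d ∧ ch e d ≤ r ∧ r < ch e (d + 1) := by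
  have hmono : ∀ d, d ≤ ch e d := by
    intro d
    induction d with
    | zero => simp
    | succ d ih => simp only [ch]; omega
  have hP : ∃ d, r < ch e (d + 1) := ⟨r, by have := hmono (r + 1); omega⟩
  by_cases h0 : r < ch e (f + 1)
  · exact ⟨f, le_rfl, h, h0⟩
  have hP : ∃ d, r < ch e (f + d + 1) := ⟨r, by have := hmono (f + r + 1); omega⟩
  refine ⟨f + Nat.find hP, by omega, ?_, Nat.find_spec hP⟩
  rcases hd : Nat.find hP with _ | d
  · simpa using h
  · have := Nat.find_min hP (m := d) (by omega)
    rw [← add_assoc]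
    omega

theorem exists_pad0 (ht : 2 ≤ t) (r : ℕ) : ∃ T : TAry t, T.plFrom 0 = r := by
  obtain ⟨d, _, h1, h2⟩ := exists_ch 0 0 r (by simp [ch])
  rw [ch] at h2
  obtain ⟨T, hT⟩ := chain_extra ht d 0 (r - ch 0 d) (by omega)
  exact ⟨T, by omega⟩

theorem exists_pad1 (ht : 2 ≤ t) (r : ℕ) (hr : 12 ≤ r) : ∃ T : TAry t, T.plFrom 1 = r := by
  obtain ⟨d, hd, h1, h2⟩ := exists_ch 1 3 (r - 2) (by simp [ch]; omega)
  rw [ch] at h2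
  obtain ⟨e, rfl⟩ : ∃ e, d = e + 1 := ⟨d - 1, by omega⟩
  have hs := ch_succ' 1 e
  by_cases hx : r - ch 1 (e + 1) = 2 ∨ e + 2 < r - ch 1 (e + 1)
  · obtain ⟨T, hT⟩ := chain_extra ht e 2 (r - ch 1 (e + 1) - 2) (by omega)
    refine ⟨two t T (two t nil nil), ?_⟩
    rw [plFrom_two ht, plFrom_two ht, hT]
    simp [plFrom]
    simp at hs
    omega
  · obtain ⟨T, hT⟩ := chain_extra ht e 2 (r - ch 1 (e + 1)) (by omega)
    refine ⟨two t T nil, ?_⟩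
    rw [plFrom_two ht, hT]
    simp [plFrom]
    simp at hs
    omega

theorem Tt_pos (ht : 2 ≤ t) (p : ℕ) : 0 < Tt t p := by
  obtain ⟨T, hT⟩ := exists_pad0 ht p
  have := card_le_Tt (p := p) {T} (by simpa [pathLength] using hT)
  rw [Finset.card_singleton] at this
  omega

theorem lower (ht : 2 ≤ t) (m k q p : ℕ) (hq : q ≤ t ^ k)
    (hp : (k + m + 1) * (t ^ k + q * m) + 12 ≤ p) : (fam t m).card ^ q ≤ Tt t p := by
  obtain ⟨S, hS1, hS2⟩ := exists_family ht m k q hq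
  have hle : ∀ T ∈ S, T.plFrom 1 + 12 ≤ p := by
    intro T hT
    have h1 := plFrom_le _ T (hS2 T hT).1 1
    have h2 := (hS2 T hT).2
    have : (1 + (k + m)) * T.size ≤ (k + m + 1) * (t ^ k + q * m) := by
      apply Nat.mul_le_mul <;> omega
    omega
  have : Nonempty (TAry t) := ⟨nil⟩
  choose! B hB using fun r => fun hr => exists_pad1 (t := t) ht r hr
  rw [← hS1, ← Finset.card_image_of_injective S
    (f := fun T => two t T (B (p - T.plFrom 1))) (fun A A' h => two_inj ht h)]
  apply card_le_Tt
  intro T hT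
  obtain ⟨A, hA, rfl⟩ := Finset.mem_image.mp hT
  have := hle A hA
  rw [pathLength, plFrom_two ht]
  simp only [zero_add]
  rw [hB _ (by omega)]
  omega

theorem upper (ht : 2 ≤ t) (p k : ℕ) (hk : 1 ≤ k) :
    Real.log (Tt t p) ≤ Real.log 2 + cst t * ((p + 2 * (t : ℝ) ^ k) / k) := by
  have hk0 : (0 : ℝ) < k := by exact_mod_cast hk
  set N : ℝ := (p + 2 * (t : ℝ) ^ k) / k with hN
  have hsz : ∀ T : TAry t, T.pathLength = p → (T.size : ℝ) ≤ N := by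
    intro T hT
    rw [hN, le_div_iff₀ hk0]
    have h1 := size_mul_le T k
    have h2 := cc_le ht k
    rw [pathLength] at hT
    have : T.size * k ≤ p + 2 * t ^ k := by omega
    exact_mod_cast this
  have hc := cst_pos ht
  have h1 : (Tt t p : ℝ) * Real.exp (-(cst t * N)) ≤ 2 := by
    refine le_trans ?_ (GH_le ht (p + 1))
    rw [Tt_eq, ← nsmul_eq_mul]
    calc _ ≤ ∑ T ∈ (treesH t (p + 1)).filter (fun T => T.pathLength = p),
          (Real.exp (-cst t)) ^ T.size := by
          apply Finset.card_nsmul_le_sum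
          intro T hT
          rw [← Real.exp_nat_mul]
          apply Real.exp_le_exp.mpr
          have := hsz T (Finset.mem_filter.mp hT).2
          nlinarith
      _ ≤ _ := Finset.sum_le_sum_of_subset_of_nonneg (Finset.filter_subset _ _)
          (fun _ _ _ => by positivity)
  have hT : (0 : ℝ) < Tt t p := by exact_mod_cast Tt_pos ht p
  have h2 := Real.log_le_log (by positivity) h1
  rw [Real.log_mul hT.ne' (Real.exp_pos _).ne', Real.log_exp] at h2
  linarith

theorem log_div_tendsto : Tendsto (fun p : ℕ => Real.log p / p) atTop (𝓝 0) := by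
  have h := (Real.isLittleO_log_id_atTop.tendsto_div_nhds_zero).comp
    (tendsto_natCast_atTop_atTop (R := ℝ))
  exact h

theorem log_tendsto : Tendsto (fun p : ℕ => Real.log p) atTop atTop :=
  Real.tendsto_log_atTop.comp (tendsto_natCast_atTop_atTop (R := ℝ))

/-- normalized logarithm of the counting function -/
noncomputable def rr (t p : ℕ) : ℝ := Real.log (Tt t p) * Real.log p / p

theorem upper_lim (ht : 2 ≤ t) (a : ℝ) (ha : cst t * Real.log t < a) :
    ∀ᶠ p : ℕ in atTop, rr t p < a := by
  have h2 : (2 : ℝ) ≤ t := by exact_mod_cast ht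
  have hL : 0 < Real.log t := Real.log_pos (by linarith)
  have hc := cst_pos ht
  set L := Real.log t with hLdef
  set c := cst t
  have hls : Tendsto (fun s : ℝ => Real.log s / s) atTop (𝓝 0) :=
    Real.isLittleO_log_id_atTop.tendsto_div_nhds_zero
  have hinv : Tendsto (fun s : ℝ => 1 / s) atTop (𝓝 0) := by
    simpa using tendsto_inv_atTop_zero (𝕜 := ℝ)
  have hden : Tendsto (fun s : ℝ => (1 - Real.log s / s) / L - 1 / s) atTop (𝓝 (1 / L)) := by
    have := ((tendsto_const_nhds (x := (1 : ℝ))).sub hls).div_const L |>.sub hinv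
    simpa using this
  have hs : Tendsto (fun s : ℝ => c * (1 + 2 * (1 / s)) * (1 / ((1 - Real.log s / s) / L - 1 / s)))
      atTop (𝓝 (c * L)) := by
    have h1 := ((hinv.const_mul 2).const_add 1).const_mul c
    have h2 := (tendsto_const_nhds (x := (1 : ℝ))).div hden (by positivity)
    have := h1.mul h2
    simpa using this
  have hu : Tendsto (fun p : ℕ => Real.log 2 * (Real.log p / p) +
      c * (1 + 2 * (1 / Real.log p)) *
        (1 / ((1 - Real.log (Real.log p) / Real.log p) / L - 1 / Real.log p)))
      atTop (𝓝 (c * L)) := by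
    have := (log_div_tendsto.const_mul (Real.log 2)).add (hs.comp log_tendsto)
    simpa using this
  have hpos := (hden.comp log_tendsto).eventually (lt_mem_nhds (show (0 : ℝ) < 1 / L by positivity))
  filter_upwards [hu.eventually (gt_mem_nhds ha), hpos, eventually_gt_atTop 0,
    log_tendsto.eventually_gt_atTop 0] with p hpa hpp hp0 hs0
  refine lt_of_le_of_lt ?_ hpa
  simp only [Function.comp] at hpp
  have hp : (0 : ℝ) < p := by exact_mod_cast hp0
  set s := Real.log p with hsdef
  set w := (s - Real.log s) / L with hw
  set k := ⌊w⌋₊ with hk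
  set D := (1 - Real.log s / s) / L - 1 / s with hD
  have hDs : s * D = w - 1 := by
    rw [hD, hw]; field_simp
  have hw1 : 0 < w - 1 := by rw [← hDs]; positivity
  have hk1 : 1 ≤ k := by
    rw [hk, Nat.one_le_floor_iff]; linarith
  have hkw : (k : ℝ) ≤ w := Nat.floor_le (by linarith)
  have hkw' : w - 1 ≤ k := by have := Nat.lt_floor_add_one w; linarith
  have hk0 : (0 : ℝ) < k := by exact_mod_cast hk1
  have htk : (t : ℝ) ^ k ≤ p / s := by
    rw [← Real.log_le_log_iff (by positivity) (by positivity), Real.log_pow,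
      Real.log_div hp.ne' hs0.ne', ← hsdef, ← hLdef]
    rw [hw, le_div_iff₀ hL] at hkw
    exact hkw
  have hup := upper ht p k hk1
  calc rr t p ≤ (Real.log 2 + c * ((p + 2 * (t : ℝ) ^ k) / k)) * s / p := by
        unfold rr
        gcongr
    _ ≤ (Real.log 2 + c * ((p + 2 * (p / s)) / (s * D))) * s / p := by
        rw [hDs]
        gcongr
    _ = _ := by
        field_simp

theorem lower_lim (ht : 2 ≤ t) (a : ℝ) (ha : a < cst t * Real.log t) :
    ∀ᶠ p : ℕ in atTop, a < rr t p := by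
  have h2 : (2 : ℝ) ≤ t := by exact_mod_cast ht
  have hL : 0 < Real.log t := Real.log_pos (by linarith)
  have hc := cst_pos ht
  set L := Real.log t with hLdef
  set c := cst t with hcdef
  -- choose δ
  obtain ⟨δ, hδ0, hδ1, hδ⟩ : ∃ δ : ℝ, 0 < δ ∧ δ < 1 ∧ a < (1 - δ) ^ 3 * (c * L) := by
    have hcont : Tendsto (fun δ : ℝ => (1 - δ) ^ 3 * (c * L)) (𝓝[>] 0) (𝓝 (c * L)) := by
      have : Continuous (fun δ : ℝ => (1 - δ) ^ 3 * (c * L)) := by fun_prop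
      have := (this.tendsto 0).mono_left (nhdsWithin_le_nhds (s := Set.Ioi 0))
      simpa using this
    have h1 := hcont.eventually (lt_mem_nhds ha)
    have h3 : ∀ᶠ δ : ℝ in 𝓝[>] 0, δ < 1 :=
      nhdsWithin_le_nhds (gt_mem_nhds (by norm_num))
    obtain ⟨δ, h⟩ := (h1.and (h3.and self_mem_nhdsWithin)).exists
    exact ⟨δ, h.2.2, h.2.1, h.1⟩
  obtain ⟨M, hM⟩ := exists_nat_ge ((t : ℝ) / δ)
  obtain ⟨m, hm, hfam⟩ := exists_m ht (η := (1 - δ) * c) (by rw [← hcdef]; nlinarith) M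
  set η := (1 - δ) * c with hη
  have hη0 : 0 < η := mul_pos (by linarith) hc
  have hmt : (t : ℝ) ≤ δ * m := by
    have : (t : ℝ) / δ ≤ m := hM.trans (by exact_mod_cast hm)
    rw [div_le_iff₀ hδ0] at this
    linarith
  have hm0 : (0 : ℝ) < m := by
    by_contra h
    nlinarith
  set β := (1 - δ) * L / (m + t) with hβ
  have hβ0 : 0 < β := div_pos (mul_pos (by linarith) hL) (by linarith)
  have hlim : a < β * (η * m) := by
    refine lt_of_lt_of_le hδ ?_
    have h5 : (1 - δ) ≤ m / (m + t) := by
      rw [le_div_iff₀ (by linarith)]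
      nlinarith
    calc (1 - δ) ^ 3 * (c * L) = ((1 - δ) * L * η) * (1 - δ) := by rw [hη]; ring
      _ ≤ ((1 - δ) * L * η) * (m / (m + t)) := by
        apply mul_le_mul_of_nonneg_left h5
        exact mul_nonneg (mul_nonneg (by linarith) hL.le) hη0.le
      _ = _ := by rw [hβ]; ring
  have hlow : Tendsto (fun p : ℕ => (β - Real.log p / p) * (η * m)) atTop (𝓝 (β * (η * m))) := by
    have := (log_div_tendsto.const_sub β).mul_const (η * m)
    simpa using this
  have hinvlog : Tendsto (fun p : ℕ => 1 / Real.log p) atTop (𝓝 0) := by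
    simp only [one_div]
    exact log_tendsto.inv_tendsto_atTop
  have hinvp : Tendsto (fun p : ℕ => 1 / (p : ℝ)) atTop (𝓝 0) := by
    simpa using tendsto_inv_atTop_nhds_zero_nat (𝕜 := ℝ)
  have hcond : Tendsto (fun p : ℕ => (1 - δ) * (1 + L * (m + 2) * (1 / Real.log p)) +
      12 * (1 / (p : ℝ))) atTop (𝓝 (1 - δ)) := by
    have := (((hinvlog.const_mul (L * (m + 2))).const_add 1).const_mul (1 - δ)).add
      (hinvp.const_mul 12)
    simpa using this
  have hq2 : Tendsto (fun p : ℕ => (Real.log p / p)) atTop (𝓝 0) := log_div_tendsto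
  filter_upwards [hlow.eventually (lt_mem_nhds hlim),
    hcond.eventually (gt_mem_nhds (show 1 - δ < 1 by linarith)),
    hq2.eventually (gt_mem_nhds (show 0 < β / 2 by positivity)),
    eventually_gt_atTop 0, log_tendsto.eventually_gt_atTop 0,
    log_tendsto.eventually_ge_atTop β] with p hpa hpc hpq hp0 hs0 hsβ
  have hp : (0 : ℝ) < p := by exact_mod_cast hp0
  refine hpa.trans_le ?_
  set s := Real.log p with hsdef
  set q := ⌊β * p / s⌋₊ with hq
  have hqle : (q : ℝ) ≤ β * p / s := Nat.floor_le (by positivity)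
  have hqge : β * p / s - 1 ≤ q := by have := Nat.lt_floor_add_one (β * p / s); linarith
  have hqtwo : 2 ≤ q := by
    rw [hq]
    apply Nat.le_floor
    rw [le_div_iff₀ hs0]
    rw [div_lt_iff₀ hp] at hpq
    push_cast
    linarith
  have hqp : (q : ℝ) ≤ p := by
    refine hqle.trans ?_
    rw [div_le_iff₀ hs0]
    nlinarith
  have hq0 : (0 : ℝ) < q := by exact_mod_cast (by omega : 0 < q)
  obtain ⟨j, hj⟩ : ∃ j, Nat.clog t q = j + 1 :=
    ⟨Nat.clog t q - 1, by have := Nat.clog_pos (b := t) (by omega) hqtwo; omega⟩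
  have hjlt : t ^ j < q := by
    have := Nat.pow_pred_clog_lt_self (b := t) (by omega) (x := q) (by omega)
    rw [hj] at this
    simpa using this
  have hqk : q ≤ t ^ (j + 1) := by
    rw [← hj]; exact Nat.le_pow_clog (by omega) q
  have hjL : (j : ℝ) ≤ s / L := by
    rw [le_div_iff₀ hL, hLdef, ← Real.log_pow, hsdef]
    apply Real.log_le_log (by positivity)
    have : ((t ^ j : ℕ) : ℝ) ≤ q := by exact_mod_cast hjlt.le
    push_cast at this
    linarith
  have hfit : ((j + 1) + m + 1) * (t ^ (j + 1) + q * m) + 12 ≤ p := by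
    have h6 : ((t : ℝ) ^ (j + 1)) ≤ t * q := by
      have : t ^ (j + 1) ≤ t * q := by
        rw [pow_succ']; exact Nat.mul_le_mul_left _ hjlt.le
      exact_mod_cast this
    have h7 : (((j : ℝ) + 1) + m + 1) * ((t : ℝ) ^ (j + 1) + q * m) + 12 ≤ p := by
      calc _ ≤ ((s / L + 1) + m + 1) * (t * q + q * m) + 12 := by gcongr
        _ = ((s / L + 1) + m + 1) * (m + t) * q + 12 := by ring
        _ ≤ ((s / L + 1) + m + 1) * (m + t) * (β * p / s) + 12 := by gcongr
        _ = ((1 - δ) * (1 + L * (m + 2) * (1 / s)) + 12 * (1 / (p : ℝ))) * p := by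
          rw [hβ]
          have : (m : ℝ) + t ≠ 0 := by linarith
          field_simp
          ring
        _ ≤ 1 * p := by gcongr
        _ = p := one_mul _
    exact_mod_cast h7
  have hlo := lower ht m (j + 1) q p hqk hfit
  have hlo' : q * (η * m) ≤ Real.log (Tt t p) := by
    rw [Real.le_log_iff_exp_le (by exact_mod_cast Tt_pos ht p), Real.exp_nat_mul]
    calc _ ≤ ((fam t m).card : ℝ) ^ q := by gcongr
      _ ≤ _ := by exact_mod_cast hlo
  calc (β - s / p) * (η * m) = (β * p / s - 1) * (η * m) * s / p := by field_simp
    _ ≤ q * (η * m) * s / p := by gcongr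
    _ ≤ rr t p := by unfold rr; gcongr

end TAry

/-- Main theorem: the number of `t`-ary trees with path length `p` is
`exp(h(1/t)·t·log t · (p / log p) · (1 + o(1)))` as `p → ∞`. -/
theorem stmt14 (t : ℕ) (ht : 2 ≤ t) :
    ∃ f : ℕ → ℝ, Filter.Tendsto f Filter.atTop (nhds 0) ∧
      ∀ p : ℕ, 2 ≤ p →
        (Tt t p : ℝ) =
          Real.exp (binEnt (1 / t) * t * Real.log t * ((p : ℝ) / Real.log p) * (1 + f p)) := by
  have h2 : (2 : ℝ) ≤ t := by exact_mod_cast ht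
  have hL : 0 < Real.log t := Real.log_pos (by linarith)
  have hc := TAry.cst_pos ht
  have hlim : Filter.Tendsto (TAry.rr t) Filter.atTop (nhds (TAry.cst t * Real.log t)) :=
    tendsto_order.mpr ⟨fun a ha => TAry.lower_lim ht a ha, fun a ha => TAry.upper_lim ht a ha⟩
  have hcL : TAry.cst t * Real.log t ≠ 0 := by positivity
  refine ⟨fun p => TAry.rr t p / (TAry.cst t * Real.log t) - 1, ?_, ?_⟩
  · have := (hlim.div_const (TAry.cst t * Real.log t)).sub_const 1
    rw [div_self hcL, sub_self] at this
    exact this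
  · intro p hp
    have hp2 : (2 : ℝ) ≤ p := by exact_mod_cast hp
    have hs : 0 < Real.log p := Real.log_pos (by linarith)
    have hT : (0 : ℝ) < Tt t p := by exact_mod_cast TAry.Tt_pos ht p
    rw [show binEnt (1 / t) * t = TAry.cst t from rfl]
    have : TAry.cst t * Real.log t * ((p : ℝ) / Real.log p) *
        (1 + (TAry.rr t p / (TAry.cst t * Real.log t) - 1)) = Real.log (Tt t p) := by
      unfold TAry.rr
      field_simp
      ring
    rw [this, Real.exp_log hT]
end
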